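/- arXiv:0706.3229 — 2 statements merged into one kernel-verified Lean document; each statement's English description precedes it below -/
import Mathlib

section
/- Let G = (ℤ/2)³, α = x₁²x₂x₃ + x₁x₂²x₃ + x₁x₂x₃² ∈ F₂[x₁,x₂,x₃], and let g = (a₁,a₂,a₃) and h = (b₁,b₂,b₃) be elements of G. Then the double inverse transgression of α equals τ_h(τ_g(α)) = (a₂b₃ + a₃b₂)·x₁² + (a₃b₁ + a₁b₃)·x₂² + (a₁b₂ + a₂b₁)·x₃²; that is, its coefficients are the components of the cross product (a₁,a₂,a₃) × (b₁,b₂,b₃) over F₂. -/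
open MvPolynomial

/-- The inverse transgression map with `F₂`-coefficients for `G = (ℤ/2)³`:
`τ_g = a₁·∂/∂x₁ + a₂·∂/∂x₂ + a₃·∂/∂x₃` on `F₂[x₁,x₂,x₃]`. -/
noncomputable def tau (g : Fin 3 → ZMod 2) (P : MvPolynomial (Fin 3) (ZMod 2)) :
    MvPolynomial (Fin 3) (ZMod 2) :=
  ∑ i : Fin 3, C (g i) * pderiv i P

/-- `α = x₁²x₂x₃ + x₁x₂²x₃ + x₁x₂x₃² ∈ F₂[x₁,x₂,x₃]`. -/
noncomputable def alpha : MvPolynomial (Fin 3) (ZMod 2) :=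
  X 0 ^ 2 * X 1 * X 2 + X 0 * X 1 ^ 2 * X 2 + X 0 * X 1 * X 2 ^ 2

lemma tau_alpha (g : Fin 3 → ZMod 2) :
    tau g alpha =
      C (g 0) * (X 1 ^ 2 * X 2 + X 1 * X 2 ^ 2) + C (g 1) * (X 0 ^ 2 * X 2 + X 0 * X 2 ^ 2) +
        C (g 2) * (X 0 ^ 2 * X 1 + X 0 * X 1 ^ 2) := by
  have h2 : (2 : MvPolynomial (Fin 3) (ZMod 2)) = 0 := CharTwo.two_eq_zero
  simp [tau, alpha, Fin.sum_univ_three, Derivation.leibniz_pow, pderiv_X, Pi.single_apply]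
  linear_combination (C (g 0) + C (g 1) + C (g 2)) * X 0 * X 1 * X 2 * h2

/-- For `g = (a₁,a₂,a₃)` and `h = (b₁,b₂,b₃)` in `(ℤ/2)³`, the double
inverse transgression of `α` is
`τ_h(τ_g(α)) = (a₂b₃+a₃b₂)x₁² + (a₃b₁+a₁b₃)x₂² + (a₁b₂+a₂b₁)x₃²`, whose
coefficients are the components of the cross product `g × h` over `F₂`. -/
theorem double_transgression_of_alpha (g h : Fin 3 → ZMod 2) :
    tau h (tau g alpha) =
      C (g 1 * h 2 + g 2 * h 1) * X 0 ^ 2 +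
        C (g 2 * h 0 + g 0 * h 2) * X 1 ^ 2 +
        C (g 0 * h 1 + g 1 * h 0) * X 2 ^ 2 := by
  have h2 : (2 : MvPolynomial (Fin 3) (ZMod 2)) = 0 := CharTwo.two_eq_zero
  rw [tau_alpha]
  simp [tau, Fin.sum_univ_three, Derivation.leibniz_pow, pderiv_X, Pi.single_apply]
  linear_combination (C (g 0) * (C (h 1) + C (h 2)) * X 1 * X 2 +
    C (g 1) * (C (h 0) + C (h 2)) * X 0 * X 2 + C (g 2) * (C (h 0) + C (h 1)) * X 0 * X 1) * h2
end

section
/- Let G = (ℤ/2)³ and α = x₁²x₂x₃ + x₁x₂²x₃ + x₁x₂x₃² ∈ F₂[x₁,x₂,x₃]. The set of pairs (g,h) ∈ G × G for which the double inverse transgression τ_h(τ_g(α)) vanishes, i.e. the set {(g,h) ∈ G × G : g = h or g = 0 or h = 0}, has exactly 22 elements. (This number is the rank of the α-twisted stringy orbifold K-theory of [*/G] tensored with ℚ, namely 2 × 7 + 8 = 22.) -/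
open MvPolynomial

/-- The double inverse transgression of `α` has the entries of the cross product of `g` and `h`
as coefficients of the squares of the variables. -/
theorem tau_tau_alpha (g h : Fin 3 → ZMod 2) :
    tau h (tau g alpha) =
      C (g 1 * h 2 + g 2 * h 1) * X 0 ^ 2 + C (g 0 * h 2 + g 2 * h 0) * X 1 ^ 2 +
        C (g 0 * h 1 + g 1 * h 0) * X 2 ^ 2 := by
  have h2 : (2 : MvPolynomial (Fin 3) (ZMod 2)) = 0 := CharTwo.two_eq_zero
  simp only [tau, alpha, Fin.sum_univ_three, map_add, Derivation.leibniz, Derivation.leibniz_pow,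
    pderiv_X, pderiv_C, Pi.single_apply, smul_eq_mul, nsmul_eq_mul, Nat.cast_ofNat, map_mul,
    Fin.reduceEq, if_true, if_false, h2]
  simp
  ring

theorem tau_tau_alpha_eq_zero_iff_coeffs (g h : Fin 3 → ZMod 2) :
    tau h (tau g alpha) = 0 ↔
      g 1 * h 2 + g 2 * h 1 = 0 ∧ g 0 * h 2 + g 2 * h 0 = 0 ∧ g 0 * h 1 + g 1 * h 0 = 0 := by
  rw [tau_tau_alpha]
  constructor
  · intro H
    have key (v : Fin 3 → ZMod 2) := congrArg (eval v) H
    exact ⟨by simpa using key ![1, 0, 0], by simpa using key ![0, 1, 0],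
      by simpa using key ![0, 0, 1]⟩
  · rintro ⟨h₀, h₁, h₂⟩
    simp [h₀, h₁, h₂]

theorem cross_eq_zero_iff :
    ∀ g h : Fin 3 → ZMod 2,
      (g 1 * h 2 + g 2 * h 1 = 0 ∧ g 0 * h 2 + g 2 * h 0 = 0 ∧ g 0 * h 1 + g 1 * h 0 = 0) ↔
        g = h ∨ g = 0 ∨ h = 0 := by
  decide

/-- For `G = (ℤ/2)³`, the set of pairs `(g,h) ∈ G × G` on which the
double inverse transgression `τ_h(τ_g(α))` vanishes is
`{(g,h) : g = h or g = 0 or h = 0}`, and it has exactly `22 = 2 × 7 + 8` elements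
(the rank of the `α`-twisted stringy orbifold K-theory of `[*/G]` tensored with `ℚ`). -/
theorem double_transgression_vanishing_set_card :
    {q : (Fin 3 → ZMod 2) × (Fin 3 → ZMod 2) | tau q.2 (tau q.1 alpha) = 0} =
      {q : (Fin 3 → ZMod 2) × (Fin 3 → ZMod 2) | q.1 = q.2 ∨ q.1 = 0 ∨ q.2 = 0} ∧
    Set.ncard
      {q : (Fin 3 → ZMod 2) × (Fin 3 → ZMod 2) | q.1 = q.2 ∨ q.1 = 0 ∨ q.2 = 0} = 22 := by
  refine ⟨?_, ?_⟩
  · ext ⟨g, h⟩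
    exact (tau_tau_alpha_eq_zero_iff_coeffs g h).trans (cross_eq_zero_iff g h)
  · rw [Set.ncard_eq_toFinset_card']
    decide
end
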